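/- Let n, a, b, s, t be integers with a ≥ b + t - 1, b ≥ 2, s ≥ 2, t ≥ 2 and n ≥ max{a+b, bt}. Suppose F ⊆ C([n],a) and G ⊆ C([n],b) are cross-intersecting families with τ(F) ≥ s and τ(G) ≥ t. Then |F| + |G| ≤ C(n,a) + Σ_{i=1}^{t} (-1)^i · C(t,i) · C(n-ib, a) + t. Moreover, when n > a+b, equality holds if and only if there exist pairwise disjoint b-element subsets B_1, …, B_t of [n] such that G = {B_1, …, B_t} and F = {A ∈ C([n],a) : A ∩ B_i ≠ ∅ for all 1 ≤ i ≤ t}. -/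

import Mathlib

open Finset

/-- Families `F` and `G` are cross-intersecting: every member of `F` meets every member of `G`. -/
def crossInt (F G : Finset (Finset ℕ)) : Prop :=
  ∀ A ∈ F, ∀ B ∈ G, (A ∩ B).Nonempty

/-- The covering number of `F` (as a family of subsets of `[n] = Icc 1 n`) is at least `s`:
every `T ⊆ [n]` meeting all members of `F` has at least `s` elements. -/
def coverGE (n s : ℕ) (F : Finset (Finset ℕ)) : Prop :=
  ∀ T : Finset ℕ, T ⊆ Finset.Icc 1 n → (∀ A ∈ F, (T ∩ A).Nonempty) → s ≤ T.card

/-- The covering number of `F` equals `s`. -/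
def coverEQ (n s : ℕ) (F : Finset (Finset ℕ)) : Prop :=
  coverGE n s F ∧
    ∃ T : Finset ℕ, T ⊆ Finset.Icc 1 n ∧ (∀ A ∈ F, (T ∩ A).Nonempty) ∧ T.card = s

/-- `F` is initial (left-shifted): replacing an element `j` of a member by a smaller `i ∈ [n]`
not in it stays in the family. -/
def initialFam (n : ℕ) (F : Finset (Finset ℕ)) : Prop :=
  ∀ A ∈ F, ∀ i ∈ Finset.Icc 1 n, ∀ j ∈ A, i < j → i ∉ A → insert i (A.erase j) ∈ F

/-- `C(n,a) + ∑_{i=1}^t (-1)^i C(t,i) C(n-ib,a) + t`, the size of `M^t(n,a,b)`. -/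
def MtSize (n a b t : ℕ) : ℤ :=
  (n.choose a : ℤ) +
    (∑ i ∈ Finset.Icc 1 t, (-1 : ℤ) ^ i * (t.choose i : ℤ) * ((n - i * b).choose a : ℤ)) + t

/-- `C(n,a) - ∑_{i=0}^{t-1} C(b+t-1,i) C(n-b-t+1,a-i) + C(b+t-1,b)`, the size of `H^t(n,a,b)`. -/
def HtSize (n a b t : ℕ) : ℤ :=
  (n.choose a : ℤ) -
    (∑ i ∈ Finset.range t, ((b + t - 1).choose i : ℤ) * ((n - b - t + 1).choose (a - i) : ℤ)) +
    ((b + t - 1).choose b : ℤ)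

/-- `∑_{i=1}^s (C(n-i,a-1) + ∑_{j=1}^{t-1} (-1)^j C(t-1,j) C(n-jb-i,a-1)) + C(n-s,b-s) + t - 1`,
the size of `M_s^t(n,a,b)`. -/
def MstSize (n a b s t : ℕ) : ℤ :=
  (∑ i ∈ Finset.Icc 1 s, (((n - i).choose (a - 1) : ℤ) +
      ∑ j ∈ Finset.Icc 1 (t - 1),
        (-1 : ℤ) ^ j * ((t - 1).choose j : ℤ) * ((n - j * b - i).choose (a - 1) : ℤ))) +
    ((n - s).choose (b - s) : ℤ) + (t : ℤ) - 1

/-- `∑_{j=1}^s (C(n-j,a-1) - ∑_{i=0}^{t-j-1} C(b+t-j-1,i) C(n-b-t+1,a-i-1))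
+ C(n-s,b-s) + C(b+t-1,b) - C(b+t-s-1,b-s)`, the size of `H_s^t(n,a,b)`. -/
def HstSize (n a b s t : ℕ) : ℤ :=
  (∑ j ∈ Finset.Icc 1 s, (((n - j).choose (a - 1) : ℤ) -
      ∑ i ∈ Finset.range (t - j),
        ((b + t - j - 1).choose i : ℤ) * ((n - b - t + 1).choose (a - i - 1) : ℤ))) +
    ((n - s).choose (b - s) : ℤ) + ((b + t - 1).choose b : ℤ) -
    ((b + t - s - 1).choose (b - s) : ℤ)

/-- Number of `a`-subsets of an `n`-set meeting `t` given disjoint `b`-sets. -/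
def hh (b a : ℕ) : ℕ → ℕ → ℤ
  | 0, n => (n.choose a : ℤ)
  | t + 1, n => hh b a t n - hh b a t (n - b)

lemma hh_pascal (b a t : ℕ) : ∀ n, b * t ≤ n →
    hh b (a + 1) t (n + 1) = hh b (a + 1) t n + hh b a t n := by
  induction t with
  | zero =>
    intro n _
    simp only [hh]
    rw [Nat.choose_succ_succ]; push_cast; ring
  | succ t ih =>
    intro n hn
    have h1 : b * (t + 1) = b * t + b := by ring
    simp only [hh]
    have h2 : n + 1 - b = (n - b) + 1 := by omega
    rw [h2, ih n (by omega), ih (n - b) (by omega)]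
    ring

lemma hh_zero (b t : ℕ) : ∀ n, hh b 0 (t + 1) n = 0 := by
  induction t with
  | zero => intro n; simp [hh]
  | succ t ih => intro n; rw [hh, ih, ih]; ring

lemma hh_mono_aux (b t : ℕ) (h : ∀ a n, b * t ≤ n → 0 ≤ hh b a t n) (a n k : ℕ)
    (hn : b * t ≤ n) : hh b a t n ≤ hh b a t (n + k) := by
  induction k with
  | zero => simp
  | succ k ih =>
    refine ih.trans ?_
    cases a with
    | zero =>
      cases t with
      | zero => simp [hh]
      | succ t => rw [hh_zero, hh_zero]
    | succ a =>
      rw [← add_assoc, hh_pascal b a t (n + k) (by omega)]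
      have := h a (n + k) (by omega)
      omega

lemma hh_nonneg (b t : ℕ) : ∀ a n, b * t ≤ n → 0 ≤ hh b a t n := by
  induction t with
  | zero => intro a n _; simp [hh]
  | succ t ih =>
    intro a n hn
    have h1 : b * (t + 1) = b * t + b := by ring
    have := hh_mono_aux b t ih a (n - b) b (by omega)
    rw [show n - b + b = n by omega] at this
    simp only [hh]; omega

lemma hh_mono (b t a n m : ℕ) (hn : b * t ≤ n) (hnm : n ≤ m) : hh b a t n ≤ hh b a t m := by
  obtain ⟨k, rfl⟩ := Nat.exists_eq_add_of_le hnm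
  exact hh_mono_aux b t (hh_nonneg b t) a n k hn

lemma choose_ge_two (n a : ℕ) (h0 : 0 < a) (h1 : a < n) : 2 ≤ n.choose a := by
  obtain ⟨n, rfl⟩ : ∃ m, n = m + 1 := ⟨n - 1, by omega⟩
  obtain ⟨a, rfl⟩ : ∃ m, a = m + 1 := ⟨a - 1, by omega⟩
  rw [Nat.choose_succ_succ']
  have := Nat.choose_pos (n := n) (k := a) (by omega)
  have := Nat.choose_pos (n := n) (k := a + 1) (by omega)
  omega

lemma hh_ge_two (b t : ℕ) (hb : 1 ≤ b) : ∀ a n, t < a → a < n → b * t ≤ n → 2 ≤ hh b a t n := by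
  induction t with
  | zero =>
    intro a n h0 h1 _
    simp only [hh]
    exact_mod_cast choose_ge_two n a h0 h1
  | succ t ih =>
    intro a n h0 h1 hn
    obtain ⟨a, rfl⟩ : ∃ m, a = m + 1 := ⟨a - 1, by omega⟩
    obtain ⟨n, rfl⟩ : ∃ m, n = m + 1 := ⟨n - 1, by omega⟩
    have e : b * (t + 1) = b * t + b := by ring
    simp only [hh]
    rw [hh_pascal b a t n (by omega)]
    have h2 := ih a n (by omega) (by omega) (by omega)
    have h3 := hh_mono b t (a + 1) (n + 1 - b) n (by omega) (by omega)
    omega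

lemma hh_formula (b a t : ℕ) : ∀ n, hh b a t n =
    ∑ i ∈ Finset.range (t + 1), (-1 : ℤ) ^ i * (t.choose i : ℤ) * ((n - i * b).choose a : ℤ) := by
  induction t with
  | zero => intro n; simp [hh]
  | succ t ih =>
    intro n
    rw [hh, ih, ih, Finset.sum_range_succ' _ (t + 1)]
    have e1 : ∀ i, n - b - i * b = n - (i + 1) * b := by
      intro i; rw [Nat.sub_sub]; congr 1; ring
    simp only [e1, Nat.choose_succ_succ t, Nat.cast_add, mul_add, add_mul, Finset.sum_add_distrib,
      pow_succ]
    have e2 : ∑ i ∈ Finset.range (t + 1), (-1 : ℤ) ^ i * (t.choose i : ℤ) * ((n - i * b).choose a : ℤ)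
      = ∑ i ∈ Finset.range (t + 1), (-1 : ℤ) ^ (i + 1) * (t.choose (i + 1) : ℤ) *
        ((n - (i + 1) * b).choose a : ℤ) + (n.choose a : ℤ) := by
      have := Finset.sum_range_succ' (fun i => (-1 : ℤ) ^ i * (t.choose i : ℤ) *
        ((n - i * b).choose a : ℤ)) (t + 1)
      rw [Finset.sum_range_succ] at this
      simpa using this
    rw [e2]
    simp only [pow_succ, Finset.sum_neg_distrib, mul_neg, mul_one, neg_mul, add_mul, one_mul]
    simp
    ring

lemma MtSize_eq (n a b t : ℕ) : MtSize n a b t = hh b a t n + t := by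
  rw [MtSize, hh_formula, Finset.sum_range_succ']
  have : Finset.Icc 1 t = (Finset.range t).image (· + 1) := by
    ext i; simp only [Finset.mem_Icc, Finset.mem_image, Finset.mem_range]
    constructor
    · intro h; exact ⟨i - 1, by omega, by omega⟩
    · rintro ⟨j, h, rfl⟩; omega
  rw [this, Finset.sum_image (by intro x _ y _ h; simpa using h)]
  simp
  ring

/-- number of `a`-sets meeting all members of a disjoint family -/
lemma card_meet (b a : ℕ) (G : Finset (Finset ℕ)) : ∀ X : Finset ℕ,
    (∀ B ∈ G, B ⊆ X ∧ B.card = b) → (∀ B ∈ G, ∀ C ∈ G, B ≠ C → Disjoint B C) →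
    (((X.powersetCard a).filter (fun A => ∀ B ∈ G, (A ∩ B).Nonempty)).card : ℤ)
      = hh b a G.card X.card := by
  induction G using Finset.induction_on with
  | empty => intro X _ _; simp [hh]
  | insert C G hC ih =>
    intro X h1 h2
    have i1 := ih X (fun B hB => h1 B (Finset.mem_insert_of_mem hB))
      (fun B hB D hD => h2 B (Finset.mem_insert_of_mem hB) D (Finset.mem_insert_of_mem hD))
    have hd : ∀ B ∈ G, Disjoint B C := fun B hB =>
      h2 B (Finset.mem_insert_of_mem hB) C (Finset.mem_insert_self _ _) (by rintro rfl; exact hC hB)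
    have i2 := ih (X \ C) (fun B hB => ⟨by
        rw [Finset.subset_sdiff]
        exact ⟨(h1 B (Finset.mem_insert_of_mem hB)).1, hd B hB⟩,
        (h1 B (Finset.mem_insert_of_mem hB)).2⟩)
      (fun B hB D hD => h2 B (Finset.mem_insert_of_mem hB) D (Finset.mem_insert_of_mem hD))
    have hCX := h1 C (Finset.mem_insert_self _ _)
    rw [Finset.card_sdiff_of_subset hCX.1, hCX.2] at i2
    rw [Finset.card_insert_of_notMem hC, hh, ← i1, ← i2]
    have hsub : ((X \ C).powersetCard a).filter (fun A => ∀ B ∈ G, (A ∩ B).Nonempty) ⊆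
      (X.powersetCard a).filter (fun A => ∀ B ∈ G, (A ∩ B).Nonempty) := by
      intro A hA
      simp only [Finset.mem_filter, Finset.mem_powersetCard] at hA ⊢
      exact ⟨⟨hA.1.1.trans Finset.sdiff_subset, hA.1.2⟩, hA.2⟩
    have hle := Finset.card_le_card hsub
    rw [← Nat.cast_sub hle, ← Finset.card_sdiff_of_subset hsub]
    congr 2
    ext A
    simp only [Finset.mem_filter, Finset.mem_powersetCard, Finset.mem_sdiff, Finset.mem_insert,
      Finset.subset_sdiff, forall_eq_or_imp, ← Finset.not_disjoint_iff_nonempty_inter]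
    tauto

/-- Covering number at least `t` within a ground set `X`. -/
def covX (X : Finset ℕ) (t : ℕ) (H : Finset (Finset ℕ)) : Prop :=
  ∀ T : Finset ℕ, T ⊆ X → (∀ A ∈ H, (T ∩ A).Nonempty) → t ≤ T.card

lemma cross_matching (X : Finset ℕ) (a c : ℕ) (F G : Finset (Finset ℕ))
    (hF : F ⊆ X.powersetCard a) (hG : G ⊆ X.powersetCard c) (hx : crossInt F G)
    (hca : c ≤ a) (hn : a + c ≤ X.card) : F.card + G.card ≤ X.card.choose a := by
  set N := (X.powersetCard a) \ F with hN
  have hNc : N.card = X.card.choose a - F.card := by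
    rw [hN, Finset.card_sdiff_of_subset hF, Finset.card_powersetCard]
  have hFc : F.card ≤ X.card.choose a := by
    rw [← Finset.card_powersetCard]; exact Finset.card_le_card hF
  have key : G.card * (X.card - c).choose a ≤ N.card * (X.card - a).choose c := by
    apply Finset.card_mul_le_card_mul (fun (B A : Finset ℕ) => Disjoint A B)
    · intro B hB
      have hB' := Finset.mem_powersetCard.1 (hG hB)
      rw [← hB'.2, ← Finset.card_sdiff_of_subset hB'.1, ← Finset.card_powersetCard]
      apply Finset.card_le_card
      intro A hA
      rw [Finset.mem_powersetCard, Finset.subset_sdiff] at hA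
      simp only [Finset.bipartiteAbove, Finset.mem_filter, hN, Finset.mem_sdiff,
        Finset.mem_powersetCard]
      refine ⟨⟨⟨hA.1.1, hA.2⟩, fun h => ?_⟩, hA.1.2⟩
      have := hx A h B hB
      rw [← Finset.not_disjoint_iff_nonempty_inter] at this
      exact this hA.1.2
    · intro A hA
      rw [hN, Finset.mem_sdiff, Finset.mem_powersetCard] at hA
      rw [← hA.1.2, ← Finset.card_sdiff_of_subset hA.1.1, ← Finset.card_powersetCard]
      apply Finset.card_le_card
      intro B hB
      simp only [Finset.bipartiteBelow, Finset.mem_filter] at hB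
      have hB' := Finset.mem_powersetCard.1 (hG hB.1)
      rw [Finset.mem_powersetCard, Finset.subset_sdiff]
      exact ⟨⟨hB'.1, hB.2.symm⟩, hB'.2⟩
  have hcmp : (X.card - a).choose c ≤ (X.card - c).choose a := by
    rw [← Nat.choose_symm (show c ≤ X.card - a by omega),
      ← Nat.choose_symm (show a ≤ X.card - c by omega),
      show X.card - a - c = X.card - c - a by omega]
    exact Nat.choose_le_choose _ (by omega)
  have hpos : 0 < (X.card - a).choose c := Nat.choose_pos (by omega)
  have : G.card ≤ N.card := by
    by_contra hlt
    push Not at hlt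
    have : N.card * (X.card - a).choose c < G.card * (X.card - c).choose a :=
      Nat.mul_lt_mul_of_lt_of_le hlt hcmp (hpos.trans_le hcmp)
    omega
  omega

lemma member_empty (x : ℕ) : (∅ : Finset (Finset ℕ)).memberSubfamily x = ∅ := by
  ext A; simp [Finset.mem_memberSubfamily]

lemma nonmember_empty (x : ℕ) : (∅ : Finset (Finset ℕ)).nonMemberSubfamily x = ∅ := by
  ext A; simp [Finset.mem_nonMemberSubfamily]

lemma member_sub (X : Finset ℕ) (a : ℕ) (F : Finset (Finset ℕ)) (x : ℕ)
    (hF : F ⊆ X.powersetCard (a + 1)) : F.memberSubfamily x ⊆ (X.erase x).powersetCard a := by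
  intro A hA
  rw [Finset.mem_memberSubfamily] at hA
  have := Finset.mem_powersetCard.1 (hF hA.1)
  rw [Finset.card_insert_of_notMem hA.2] at this
  rw [Finset.mem_powersetCard, Finset.subset_erase]
  exact ⟨⟨(Finset.subset_insert _ _).trans this.1, hA.2⟩, by omega⟩

lemma nonmember_sub (X : Finset ℕ) (a : ℕ) (F : Finset (Finset ℕ)) (x : ℕ)
    (hF : F ⊆ X.powersetCard a) : F.nonMemberSubfamily x ⊆ (X.erase x).powersetCard a := by
  intro A hA
  rw [Finset.mem_nonMemberSubfamily] at hA
  have := Finset.mem_powersetCard.1 (hF hA.1)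
  rw [Finset.mem_powersetCard, Finset.subset_erase]
  exact ⟨⟨this.1, hA.2⟩, this.2⟩

lemma cross_mn (F G : Finset (Finset ℕ)) (x : ℕ) (h : crossInt F G) :
    crossInt (F.memberSubfamily x) (G.nonMemberSubfamily x) := by
  intro A hA B hB
  rw [Finset.mem_memberSubfamily] at hA
  rw [Finset.mem_nonMemberSubfamily] at hB
  have := h _ hA.1 B hB.1
  rwa [Finset.insert_inter_of_notMem hB.2] at this

lemma cross_symm (F G : Finset (Finset ℕ)) (h : crossInt F G) : crossInt G F := by
  intro A hA B hB
  rw [Finset.inter_comm]; exact h B hB A hA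

lemma cross_nm (F G : Finset (Finset ℕ)) (x : ℕ) (h : crossInt F G) :
    crossInt (F.nonMemberSubfamily x) (G.memberSubfamily x) :=
  cross_symm _ _ (cross_mn _ _ x (cross_symm _ _ h))

lemma cross_n (F G : Finset (Finset ℕ)) (x : ℕ) (h : crossInt F G) :
    crossInt (F.nonMemberSubfamily x) G := by
  intro A hA B hB
  rw [Finset.mem_nonMemberSubfamily] at hA
  exact h A hA.1 B hB

lemma covX_nonmember (X : Finset ℕ) (t : ℕ) (H : Finset (Finset ℕ)) (x : ℕ) (hx : x ∈ X)
    (h : covX X (t + 1) H) : covX (X.erase x) t (H.nonMemberSubfamily x) := by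
  intro T hT hc
  rw [Finset.subset_erase] at hT
  have := h (insert x T) (Finset.insert_subset hx hT.1) (by
    intro A hA
    by_cases hxA : x ∈ A
    · exact ⟨x, by simp [hxA]⟩
    · rw [Finset.insert_inter_of_notMem hxA]
      exact hc A (Finset.mem_nonMemberSubfamily.2 ⟨hA, hxA⟩))
  rw [Finset.card_insert_of_notMem hT.2] at this
  omega

lemma covX_mono (X Y : Finset ℕ) (t : ℕ) (H : Finset (Finset ℕ)) (hYX : Y ⊆ X)
    (h : covX X t H) : covX Y t H := fun T hT hc => h T (hT.trans hYX) hc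

/-- The bound when the counted sets of `G` have size `c < b`. -/
def SBound (b t : ℕ) : Prop :=
  ∀ (X : Finset ℕ) (a c : ℕ) (F G H : Finset (Finset ℕ)),
    b * t ≤ X.card → t ≤ a → F ⊆ X.powersetCard a → crossInt F H → covX X t H →
    (∀ B ∈ H, B.card ≤ b) → G ⊆ X.powersetCard c → crossInt F G →
    (G = ∅ ∨ (c < b ∧ c + t ≤ a ∧ a + c ≤ X.card)) →
    (F.card : ℤ) + G.card ≤ hh b a t X.card

lemma split_card (F : Finset (Finset ℕ)) (x : ℕ) :
    (F.card : ℤ) = (F.memberSubfamily x).card + (F.nonMemberSubfamily x).card := by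
  rw [← Finset.card_memberSubfamily_add_card_nonMemberSubfamily x F]; push_cast; rfl

lemma S_branch1 (b t : ℕ) (hS : SBound b t) (X : Finset ℕ) (a c : ℕ)
    (F G H : Finset (Finset ℕ)) (x : ℕ) (hxX : x ∈ X) (hn : b * t + 1 ≤ X.card) (ha : t ≤ a)
    (hF : F ⊆ X.powersetCard (a + 1)) (hFH : crossInt F H) (hH : covX X (t + 1) H)
    (hHb : ∀ B ∈ H, B.card ≤ b) (hG : G ⊆ X.powersetCard c) (hFG : crossInt F G)
    (hc : G = ∅ ∨ (c < b ∧ c + t ≤ a ∧ a + 1 + c ≤ X.card)) :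
    ((F.memberSubfamily x).card : ℤ) + (G.nonMemberSubfamily x).card ≤ hh b a t (X.card - 1) := by
  have hX' : (X.erase x).card = X.card - 1 := Finset.card_erase_of_mem hxX
  rw [← hX']
  refine hS (X.erase x) a c _ _ (H.nonMemberSubfamily x) (by omega) ha (member_sub _ _ _ _ hF)
    (cross_mn _ _ _ hFH) (covX_nonmember _ _ _ _ hxX hH) ?_ (nonmember_sub _ _ _ _ hG)
    (cross_mn _ _ _ hFG) ?_
  · intro B hB; exact hHb B (Finset.mem_nonMemberSubfamily.1 hB).1
  · rcases hc with rfl | hc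
    · left; exact nonmember_empty x
    · right; omega

lemma erase_notMem_member (G : Finset (Finset ℕ)) (B : Finset ℕ) (x : ℕ) (hx : x ∈ B)
    (h : B ∉ G) : B.erase x ∉ G.memberSubfamily x := by
  rw [Finset.mem_memberSubfamily, Finset.insert_erase hx]; exact fun hh => h hh.1

lemma S_peel (b t : ℕ) (hS : SBound b t) (k : ℕ) :
    ∀ (X : Finset ℕ) (a c : ℕ) (F G H : Finset (Finset ℕ)) (B : Finset ℕ),
    B.card = k → B ⊆ X → b * t + k ≤ X.card → t + 1 ≤ a → F ⊆ X.powersetCard a →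
    crossInt F H → (∀ A ∈ F, (A ∩ B).Nonempty) → covX X (t + 1) H →
    (∀ B ∈ H, B.card ≤ b) → G ⊆ X.powersetCard c → crossInt F G →
    (G = ∅ ∨ (c ≤ k ∧ B ∉ G ∧ c < b ∧ c + t + 1 ≤ a ∧ a + c ≤ X.card)) →
    (F.card : ℤ) + G.card ≤ hh b a t X.card - hh b a t (X.card - k) := by
  induction k with
  | zero =>
    intro X a c F G H B hBk hBX hn ha hF hFH hFB hH hHb hG hFG hc
    have hB : B = ∅ := Finset.card_eq_zero.1 hBk
    subst hB
    have hF0 : F = ∅ := by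
      rw [Finset.eq_empty_iff_forall_notMem]
      intro A hA
      simpa using hFB A hA
    have hG0 : G = ∅ := by
      rcases hc with h | ⟨h0, h1, _⟩
      · exact h
      · rw [Finset.eq_empty_iff_forall_notMem]
        intro S hS'
        have := (Finset.mem_powersetCard.1 (hG hS')).2
        have : S = ∅ := Finset.card_eq_zero.1 (by omega)
        exact h1 (this ▸ hS')
    subst hF0 hG0
    simp
  | succ k ih =>
    intro X a c F G H B hBk hBX hn ha hF hFH hFB hH hHb hG hFG hc
    obtain ⟨a, rfl⟩ : ∃ m, a = m + 1 := ⟨a - 1, by omega⟩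
    obtain ⟨x, hx⟩ : B.Nonempty := Finset.card_pos.1 (by omega)
    have hxX := hBX hx
    have hX' : (X.erase x).card = X.card - 1 := Finset.card_erase_of_mem hxX
    have b1 := S_branch1 b t hS X a c F G H x hxX (by omega) (by omega) hF hFH hH hHb hG hFG (by
      rcases hc with h | h
      · left; exact h
      · right; omega)
    have b2 : ((F.nonMemberSubfamily x).card : ℤ) + (G.memberSubfamily x).card
        ≤ hh b (a + 1) t (X.card - 1) - hh b (a + 1) t (X.card - 1 - k) := by
      rw [← hX']
      have hcomm : G.memberSubfamily x ⊆ (X.erase x).powersetCard (c - 1) := by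
        cases c with
        | zero =>
          intro S hS'
          rw [Finset.mem_memberSubfamily] at hS'
          have := (Finset.mem_powersetCard.1 (hG hS'.1)).2
          simp at this
        | succ c => exact member_sub _ _ _ _ hG
      refine ih (X.erase x) (a + 1) (c - 1) _ _ H (B.erase x)
        (by rw [Finset.card_erase_of_mem hx]; omega) (Finset.erase_subset_erase _ hBX) (by omega) ha
        (nonmember_sub _ _ _ _ hF) (cross_n _ _ _ hFH) ?_ (covX_mono _ _ _ _ (Finset.erase_subset _ _) hH)
        hHb hcomm (cross_nm _ _ _ hFG) ?_
      · intro A hA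
        rw [Finset.mem_nonMemberSubfamily] at hA
        have := hFB A hA.1
        rwa [← Finset.erase_eq_of_notMem hA.2, Finset.erase_inter_comm] at this
      · rcases hc with rfl | ⟨h1, h2, h3, h4, h5⟩
        · left; exact member_empty x
        · cases c with
          | zero =>
            left
            rw [Finset.eq_empty_iff_forall_notMem]
            intro S hS'
            rw [Finset.mem_memberSubfamily] at hS'
            have := (Finset.mem_powersetCard.1 (hG hS'.1)).2
            simp at this
          | succ c =>
            right
            refine ⟨by omega, erase_notMem_member _ _ _ hx h2, by omega, by omega, by omega⟩
    have e1 := split_card F x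
    have e2 := split_card G x
    have e3 := hh_pascal b a t (X.card - 1) (by omega)
    rw [show X.card - 1 + 1 = X.card by omega] at e3
    rw [show X.card - 1 - k = X.card - (k + 1) by omega] at b2
    omega

lemma exists_pad (X B : Finset ℕ) (b : ℕ) (hB : B.card ≤ b) (hX : b ≤ X.card) :
    ∃ C, B ∩ X ⊆ C ∧ C ⊆ X ∧ C.card = b := by
  apply Finset.exists_subsuperset_card_eq Finset.inter_subset_right _ hX
  exact (Finset.card_le_card Finset.inter_subset_left).trans hB

lemma meet_pad (X A B C : Finset ℕ) (hA : A ⊆ X) (hC : B ∩ X ⊆ C) (h : (A ∩ B).Nonempty) :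
    (A ∩ C).Nonempty := by
  obtain ⟨y, hy⟩ := h
  rw [Finset.mem_inter] at hy
  exact ⟨y, Finset.mem_inter.2 ⟨hy.1, hC (Finset.mem_inter.2 ⟨hy.2, hA hy.1⟩)⟩⟩

lemma covX_nonempty (X : Finset ℕ) (t : ℕ) (H : Finset (Finset ℕ)) (h : covX X (t + 1) H) :
    H.Nonempty := by
  rw [Finset.nonempty_iff_ne_empty]
  rintro rfl
  have := h ∅ (Finset.empty_subset _) (by simp)
  simp at this

lemma SBound_all (b t : ℕ) : SBound b t := by
  induction t with
  | zero =>
    intro X a c F G H _ _ hF _ _ _ hG hFG hc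
    simp only [hh]
    rcases hc with rfl | hc
    · have := Finset.card_le_card hF
      rw [Finset.card_powersetCard] at this
      simpa using this
    · exact_mod_cast cross_matching X a c F G hF hG hFG (by omega) (by omega)
  | succ t ih =>
    intro X a c F G H hn ha hF hFH hH hHb hG hFG hc
    have e : b * (t + 1) = b * t + b := by ring
    obtain ⟨B, hB⟩ := covX_nonempty X t H hH
    obtain ⟨C, hC1, hC2, hC3⟩ := exists_pad X B b (hHb B hB) (by omega)
    rw [hh]
    refine S_peel b t ih b X a c F G H C hC3 hC2 (by omega) ha hF hFH ?_ hH hHb hG hFG ?_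
    · intro A hA
      exact meet_pad X A B C (Finset.mem_powersetCard.1 (hF hA)).1 hC1 (hFH A hA B hB)
    · rcases hc with h | h
      · left; exact h
      · right
        refine ⟨by omega, fun hCG => ?_, by omega, by omega, by omega⟩
        have := (Finset.mem_powersetCard.1 (hG hCG)).2
        omega

/-- Strict version of the peeling lemma when a member of `G` is a proper subset of `B`. -/
lemma S_peel_strict (b t : ℕ) (hb : 1 ≤ b) (c : ℕ) :
    ∀ (k : ℕ) (X : Finset ℕ) (a : ℕ) (F G H : Finset (Finset ℕ)) (B S : Finset ℕ),
    B.card = k → B ⊆ X → b * t + k ≤ X.card → t + 2 ≤ a → F ⊆ X.powersetCard a →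
    crossInt F H → covX X (t + 1) H →
    (∀ B ∈ H, B.card ≤ b) → G ⊆ X.powersetCard c → crossInt F G →
    S ∈ G → S ⊆ B → c < k → k ≤ b → c + t + 1 ≤ a → a + c < X.card →
    (F.card : ℤ) + G.card < hh b a t X.card - hh b a t (X.card - k) := by
  induction c with
  | zero =>
    intro k X a F G H B S hBk hBX hn ha hF hFH hH hHb hG hFG hSG hSB hck hkb hca hcn
    obtain ⟨a, rfl⟩ : ∃ m, a = m + 1 := ⟨a - 1, by omega⟩
    have hS0 : S = ∅ := Finset.card_eq_zero.1 (Finset.mem_powersetCard.1 (hG hSG)).2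
    subst hS0
    have hF0 : F = ∅ := by
      rw [Finset.eq_empty_iff_forall_notMem]
      intro A hA
      simpa using hFG A hA _ hSG
    have hG1 : G.card ≤ 1 := by
      have := Finset.card_le_card hG
      simpa using this
    have e3 := hh_pascal b a t (X.card - 1) (by omega)
    rw [show X.card - 1 + 1 = X.card by omega] at e3
    have h2 := hh_ge_two b t hb a (X.card - 1) (by omega) (by omega) (by omega)
    have h3 := hh_mono b t (a + 1) (X.card - k) (X.card - 1) (by omega) (by omega)
    subst hF0
    simp only [Finset.card_empty]
    omega
  | succ c ih =>
    intro k X a F G H B S hBk hBX hn ha hF hFH hH hHb hG hFG hSG hSB hck hkb hca hcn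
    obtain ⟨a, rfl⟩ : ∃ m, a = m + 1 := ⟨a - 1, by omega⟩
    have hSc := (Finset.mem_powersetCard.1 (hG hSG)).2
    obtain ⟨x, hxS⟩ : S.Nonempty := Finset.card_pos.1 (by omega)
    have hx := hSB hxS
    have hxX := hBX hx
    have hX' : (X.erase x).card = X.card - 1 := Finset.card_erase_of_mem hxX
    have b1 := S_branch1 b t (SBound_all b t) X a (c + 1) F G H x hxX (by omega) (by omega)
      hF hFH hH hHb hG hFG (by right; omega)
    have b2 := ih (k - 1) (X.erase x) (a + 1) (F.nonMemberSubfamily x) (G.memberSubfamily x) H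
      (B.erase x) (S.erase x) (by rw [Finset.card_erase_of_mem hx]; omega)
      (Finset.erase_subset_erase _ hBX) (by omega) ha
      (nonmember_sub _ _ _ _ hF) (cross_n _ _ _ hFH)
      (covX_mono _ _ _ _ (Finset.erase_subset _ _) hH) hHb (member_sub _ _ _ _ hG)
      (cross_nm _ _ _ hFG)
      (by rw [Finset.mem_memberSubfamily, Finset.insert_erase hxS]; exact ⟨hSG, by simp⟩)
      (Finset.erase_subset_erase _ hSB) (by omega) (by omega) (by omega) (by omega)
    have e1 := split_card F x
    have e2 := split_card G x
    have e3 := hh_pascal b a t (X.card - 1) (by omega)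
    rw [show X.card - 1 + 1 = X.card by omega] at e3
    rw [hX', show X.card - 1 - (k - 1) = X.card - k by omega] at b2
    omega

lemma S_strict (b t : ℕ) (X : Finset ℕ) (a c : ℕ) (F G H : Finset (Finset ℕ))
    (hn : b * (t + 1) ≤ X.card) (hF : F ⊆ X.powersetCard a) (hFH : crossInt F H)
    (hH : covX X (t + 1) H) (hHb : ∀ B ∈ H, B.card ≤ b) (hG : G ⊆ X.powersetCard c)
    (hFG : crossInt F G) (hG0 : G.Nonempty) (hc0 : 1 ≤ c) (hcb : c < b) (hca : c + t + 1 ≤ a)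
    (hcn : a + c < X.card) : (F.card : ℤ) + G.card < hh b a (t + 1) X.card := by
  obtain ⟨S, hS⟩ := hG0
  have e : b * (t + 1) = b * t + b := by ring
  have hS' := Finset.mem_powersetCard.1 (hG hS)
  obtain ⟨C, hC1, hC2, hC3⟩ := exists_pad X S b (by omega) (by omega)
  rw [hh]
  refine S_peel_strict b t (by omega) c b X a F G H C S hC3 hC2 (by omega) (by omega) hF hFH hH hHb
    hG hFG hS ?_ hcb le_rfl hca hcn
  rwa [Finset.inter_eq_left.2 hS'.1] at hC1

/-- Strict peeling lemma, `t ≥ 1`. -/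
lemma S_peel_strict' (b t : ℕ) (k : ℕ)
    (X : Finset ℕ) (a c : ℕ) (F G H : Finset (Finset ℕ)) (B : Finset ℕ)
    (hBk : B.card = k) (hBX : B ⊆ X) (hn : b * (t + 1) + k ≤ X.card) (hF : F ⊆ X.powersetCard a)
    (hFH : crossInt F H) (hFB : ∀ A ∈ F, (A ∩ B).Nonempty) (hH : covX X (t + 2) H)
    (hHb : ∀ B ∈ H, B.card ≤ b) (hG : G ⊆ X.powersetCard c) (hFG : crossInt F G)
    (hG0 : G.Nonempty) (hBG : B ∉ G) (hck : c = k) (hc0 : 1 ≤ c) (hcb : c < b)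
    (hca : c + t + 2 ≤ a) (hcn : a + c < X.card) :
    (F.card : ℤ) + G.card < hh b a (t + 1) X.card - hh b a (t + 1) (X.card - k) := by
  obtain ⟨S, hS⟩ := hG0
  obtain ⟨a, rfl⟩ : ∃ m, a = m + 1 := ⟨a - 1, by omega⟩
  have hS' := Finset.mem_powersetCard.1 (hG hS)
  obtain ⟨x, hx, hxS⟩ : ∃ x ∈ B, x ∉ S := by
    by_contra hcon
    push Not at hcon
    have : B = S := Finset.eq_of_subset_of_card_le hcon (by omega)
    exact hBG (this ▸ hS)
  have hxX := hBX hx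
  have hX' : (X.erase x).card = X.card - 1 := Finset.card_erase_of_mem hxX
  have b1 := S_strict b t (X.erase x) a c (F.memberSubfamily x) (G.nonMemberSubfamily x)
    (H.nonMemberSubfamily x) (by omega) (member_sub _ _ _ _ hF)
    (cross_mn _ _ _ hFH) (covX_nonmember _ _ _ _ hxX hH)
    (fun B hB => hHb B (Finset.mem_nonMemberSubfamily.1 hB).1) (nonmember_sub _ _ _ _ hG)
    (cross_mn _ _ _ hFG) ⟨S, Finset.mem_nonMemberSubfamily.2 ⟨hS, hxS⟩⟩ hc0 hcb (by omega) (by omega)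
  obtain ⟨c, rfl⟩ : ∃ m, c = m + 1 := ⟨c - 1, by omega⟩
  have b2 := S_peel b (t + 1) (SBound_all b (t + 1)) c (X.erase x) (a + 1) c
    (F.nonMemberSubfamily x) (G.memberSubfamily x) H (B.erase x)
    (by rw [Finset.card_erase_of_mem hx]; omega) (Finset.erase_subset_erase _ hBX) (by omega)
    (by omega) (nonmember_sub _ _ _ _ hF) (cross_n _ _ _ hFH) (by
      intro A hA
      rw [Finset.mem_nonMemberSubfamily] at hA
      have := hFB A hA.1
      rwa [← Finset.erase_eq_of_notMem hA.2, Finset.erase_inter_comm] at this)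
    (covX_mono _ _ _ _ (Finset.erase_subset _ _) hH) hHb (member_sub _ _ _ _ hG)
    (cross_nm _ _ _ hFG)
    (Or.inr ⟨le_rfl, erase_notMem_member _ _ _ hx hBG, by omega, by omega, by omega⟩)
  have e1 := split_card F x
  have e2 := split_card G x
  have e3 := hh_pascal b a (t + 1) (X.card - 1) (by omega)
  rw [show X.card - 1 + 1 = X.card by omega] at e3
  rw [hX'] at b1
  rw [hX', show X.card - 1 - c = X.card - k by omega] at b2
  omega

lemma T_step_aux (b t : ℕ) (hb : 1 ≤ b) (X : Finset ℕ) (a : ℕ) (F G : Finset (Finset ℕ))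
    (B : Finset ℕ) (x : ℕ) (hn : b * (t + 1) ≤ X.card) (hF : F ⊆ X.powersetCard (a + 1))
    (hG : G ⊆ X.powersetCard b) (hFG : crossInt F G) (hcov : covX X (t + 1) G) (hB : B ∈ G)
    (hx : x ∈ B) (ha : b + t ≤ a + 1) (han : a + 1 + b ≤ X.card) :
    (F.nonMemberSubfamily x).card + (((G.memberSubfamily x).erase (B.erase x)).card : ℤ) ≤
      hh b (a + 1) t (X.card - 1) - hh b (a + 1) t (X.card - b) ∧
    (∀ u, t = u + 1 → 2 ≤ b → a + 1 + b < X.card →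
      ((G.memberSubfamily x).erase (B.erase x)).Nonempty →
      (F.nonMemberSubfamily x).card + (((G.memberSubfamily x).erase (B.erase x)).card : ℤ) <
      hh b (a + 1) t (X.card - 1) - hh b (a + 1) t (X.card - b)) := by
  have e : b * (t + 1) = b * t + b := by ring
  have hB' := Finset.mem_powersetCard.1 (hG hB)
  have hxX := hB'.1 hx
  have hX' : (X.erase x).card = X.card - 1 := Finset.card_erase_of_mem hxX
  obtain ⟨c, rfl⟩ : ∃ m, b = m + 1 := ⟨b - 1, by omega⟩
  have h1 : (B.erase x).card = c := by rw [Finset.card_erase_of_mem hx]; omega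
  have h2 : (B.erase x) ⊆ X.erase x := Finset.erase_subset_erase _ hB'.1
  have h3 : ∀ A ∈ F.nonMemberSubfamily x, (A ∩ B.erase x).Nonempty := by
    intro A hA
    rw [Finset.mem_nonMemberSubfamily] at hA
    have := hFG A hA.1 B hB
    rwa [← Finset.erase_eq_of_notMem hA.2, Finset.erase_inter_comm] at this
  have h4 : ∀ B ∈ G, B.card ≤ c + 1 := fun D hD => (Finset.mem_powersetCard.1 (hG hD)).2.le
  have h5 : (G.memberSubfamily x).erase (B.erase x) ⊆ (X.erase x).powersetCard c :=
    (Finset.erase_subset _ _).trans (member_sub _ _ _ _ hG)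
  have h6 : crossInt (F.nonMemberSubfamily x) ((G.memberSubfamily x).erase (B.erase x)) :=
    fun A hA D hD => cross_nm _ _ x hFG A hA D (Finset.mem_of_mem_erase hD)
  have h7 := covX_mono _ _ _ _ (Finset.erase_subset x X) hcov
  have e9 : X.card - (c + 1) = X.card - 1 - c := by omega
  constructor
  · have := S_peel (c + 1) t (SBound_all _ t) c (X.erase x) (a + 1) c _ _ G (B.erase x)
      h1 h2 (by omega) (by omega) (nonmember_sub _ _ _ _ hF) (cross_n _ _ x hFG) h3 h7
      h4 h5 h6 (Or.inr ⟨le_rfl, Finset.notMem_erase _ _, by omega, by omega, by omega⟩)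
    rwa [hX', ← e9] at this
  · rintro u rfl hc2 hlt hne
    have := S_peel_strict' (c + 1) u c (X.erase x) (a + 1) c _ _ G (B.erase x)
      h1 h2 (by omega) (nonmember_sub _ _ _ _ hF) (cross_n _ _ x hFG) h3 h7
      h4 h5 h6 hne (Finset.notMem_erase _ _) rfl (by omega) (by omega) (by omega) (by omega)
    rwa [hX', ← e9] at this

lemma T_step (b t : ℕ) (hb : 1 ≤ b) (X : Finset ℕ) (a : ℕ) (F G : Finset (Finset ℕ))
    (B : Finset ℕ) (x : ℕ) (hn : b * (t + 1) ≤ X.card) (hF : F ⊆ X.powersetCard (a + 1))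
    (hG : G ⊆ X.powersetCard b) (hFG : crossInt F G) (hcov : covX X (t + 1) G) (hB : B ∈ G)
    (hx : x ∈ B) (ha : b + t ≤ a + 1) (han : a + 1 + b ≤ X.card)
    (hbr : ((F.memberSubfamily x).card : ℤ) + (G.nonMemberSubfamily x).card
      ≤ hh b a t (X.card - 1) + t) :
    (F.card : ℤ) + G.card ≤ hh b (a + 1) (t + 1) X.card + (t + 1 : ℕ) ∧
    (∀ u, t = u + 1 → 2 ≤ b → a + 1 + b < X.card → ∀ D ∈ G, D ≠ B → x ∈ D →
      (F.card : ℤ) + G.card < hh b (a + 1) (t + 1) X.card + (t + 1 : ℕ)) := by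
  have e : b * (t + 1) = b * t + b := by ring
  obtain ⟨h1, h2⟩ := T_step_aux b t hb X a F G B x hn hF hG hFG hcov hB hx ha han
  have hmem : B.erase x ∈ G.memberSubfamily x := by
    rw [Finset.mem_memberSubfamily, Finset.insert_erase hx]; exact ⟨hB, by simp⟩
  have hc := Finset.card_erase_add_one hmem
  have e1 := split_card F x
  have e2 := split_card G x
  have e3 := hh_pascal b a t (X.card - 1) (by omega)
  rw [show X.card - 1 + 1 = X.card by omega] at e3
  rw [hh]
  constructor
  · push_cast; omega
  · intro u hu hb2 hlt D hD hDB hxD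
    have := h2 u hu hb2 hlt ⟨D.erase x, by
      rw [Finset.mem_erase, Finset.mem_memberSubfamily, Finset.insert_erase hxD]
      refine ⟨fun h => hDB ?_, hD, by simp⟩
      rw [← Finset.insert_erase hxD, h, Finset.insert_erase hx]⟩
    push_cast; omega

/-- image of a family under a permutation -/
def pmap (σ : Equiv.Perm ℕ) (G : Finset (Finset ℕ)) : Finset (Finset ℕ) :=
  G.map (Finset.mapEmbedding σ.toEmbedding).toEmbedding

lemma mem_pmap (σ : Equiv.Perm ℕ) (G : Finset (Finset ℕ)) (A : Finset ℕ) :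
    A ∈ pmap σ G ↔ ∃ B ∈ G, B.map σ.toEmbedding = A := by
  simp [pmap, Finset.mapEmbedding]

lemma map_swap_subset (X B : Finset ℕ) (u v : ℕ) (hu : u ∈ X) (hv : v ∈ X) (hB : B ⊆ X) :
    B.map (Equiv.swap u v).toEmbedding ⊆ X := by
  intro y hy
  rw [Finset.mem_map] at hy
  obtain ⟨z, hz, rfl⟩ := hy
  simp only [Equiv.coe_toEmbedding]
  rw [Equiv.swap_apply_def]
  split_ifs
  · exact hv
  · exact hu
  · exact hB hz

lemma mem_map_swap (B : Finset ℕ) (u v y : ℕ) :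
    y ∈ B.map (Equiv.swap u v).toEmbedding ↔ Equiv.swap u v y ∈ B := by
  rw [Finset.mem_map_equiv, Equiv.symm_swap]

lemma frag_choice (V : Finset (Finset ℕ)) (F G : Finset (Finset ℕ)) (hF : F ⊆ V) (hG : G ⊆ V)
    (hF0 : F.Nonempty) (hG0 : G.Nonempty) (hx : crossInt F G) :
    ∃ F' G', F' ⊆ V ∧ G' ⊆ V ∧ F'.Nonempty ∧ G'.Nonempty ∧ crossInt F' G' ∧
      F.card + G.card ≤ F'.card + G'.card ∧
      ∀ P Q, P ⊆ V → Q ⊆ V → P.Nonempty → Q.Nonempty → crossInt P Q →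
        P.card + Q.card ≤ F'.card + G'.card ∧
        (P.card + Q.card = F'.card + G'.card → G'.card ≤ Q.card) := by
  classical
  let S := (V.powerset ×ˢ V.powerset).filter
    (fun p => p.1.Nonempty ∧ p.2.Nonempty ∧ crossInt p.1 p.2)
  have hS : ∀ P Q, (P, Q) ∈ S ↔ (P ⊆ V ∧ Q ⊆ V) ∧ P.Nonempty ∧ Q.Nonempty ∧ crossInt P Q := by
    intro P Q; simp [S]
  have hne : S.Nonempty := ⟨(F, G), (hS _ _).2 ⟨⟨hF, hG⟩, hF0, hG0, hx⟩⟩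
  obtain ⟨p, hp, hmax⟩ := S.exists_max_image (fun p => p.1.card + p.2.card) hne
  obtain ⟨q, hq, hmin⟩ := (S.filter (fun q => q.1.card + q.2.card = p.1.card + p.2.card)).exists_min_image
    (fun q => q.2.card) ⟨p, by simp [hp]⟩
  obtain ⟨F', G'⟩ := q
  rw [Finset.mem_filter, hS] at hq
  obtain ⟨⟨⟨a1, a2⟩, a3, a4, a5⟩, a6⟩ := hq
  simp only at a6
  refine ⟨F', G', a1, a2, a3, a4, a5, ?_, ?_⟩
  · rw [a6]; exact hmax (F, G) ((hS _ _).2 ⟨⟨hF, hG⟩, hF0, hG0, hx⟩)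
  · intro P Q h1 h2 h3 h4 h5
    have hm : (P, Q) ∈ S := (hS _ _).2 ⟨⟨h1, h2⟩, h3, h4, h5⟩
    rw [a6]
    refine ⟨hmax _ hm, fun h => ?_⟩
    exact hmin (P, Q) (by rw [Finset.mem_filter]; exact ⟨hm, h⟩)

lemma cross_pmap (σ : Equiv.Perm ℕ) (F G : Finset (Finset ℕ)) (h : crossInt F G) :
    crossInt (pmap σ F) (pmap σ G) := by
  intro A hA B hB
  rw [mem_pmap] at hA hB
  obtain ⟨A, hA, rfl⟩ := hA
  obtain ⟨B, hB, rfl⟩ := hB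
  rw [← Finset.map_inter, Finset.map_nonempty]
  exact h A hA B hB

lemma frag_block (V F G : Finset (Finset ℕ)) (hF : F ⊆ V) (hG : G ⊆ V)
    (hF0 : F.Nonempty) (hG0 : G.Nonempty) (hx : crossInt F G)
    (hopt : ∀ P Q, P ⊆ V → Q ⊆ V → P.Nonempty → Q.Nonempty → crossInt P Q →
        P.card + Q.card ≤ F.card + G.card ∧
        (P.card + Q.card = F.card + G.card → G.card ≤ Q.card))
    (σ : Equiv.Perm ℕ) (hσ : ∀ A ∈ V, A.map σ.toEmbedding ∈ V)
    (hne : (G ∩ pmap σ G).Nonempty) : ∀ B ∈ G, B.map σ.toEmbedding ∈ G := by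
  have hFσ : pmap σ F ⊆ V := by
    intro A hA; rw [mem_pmap] at hA; obtain ⟨B, hB, rfl⟩ := hA; exact hσ B (hF hB)
  have hGσ : pmap σ G ⊆ V := by
    intro A hA; rw [mem_pmap] at hA; obtain ⟨B, hB, rfl⟩ := hA; exact hσ B (hG hB)
  have cF : (pmap σ F).card = F.card := Finset.card_map _
  have cG : (pmap σ G).card = G.card := Finset.card_map _
  have hxσ := cross_pmap σ F G hx
  have o1 := hopt (F ∪ pmap σ F) (G ∩ pmap σ G) (Finset.union_subset hF hFσ)
    (Finset.inter_subset_left.trans hG) (hF0.mono Finset.subset_union_left) hne (by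
      intro A hA B hB
      rw [Finset.mem_inter] at hB
      rcases Finset.mem_union.1 hA with h | h
      · exact hx A h B hB.1
      · exact hxσ A h B hB.2)
  have uF := Finset.card_union_add_card_inter F (pmap σ F)
  have uG := Finset.card_union_add_card_inter G (pmap σ G)
  have o0 := (hopt G F hG hF hG0 hF0 (cross_symm _ _ hx)).2 (by omega)
  have hpos := Finset.card_pos.2 hne
  have hneF : (F ∩ pmap σ F).Nonempty := by
    rw [← Finset.card_pos]
    by_contra h0
    omega
  have o2 := hopt (F ∩ pmap σ F) (G ∪ pmap σ G) (Finset.inter_subset_left.trans hF)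
    (Finset.union_subset hG hGσ) hneF (hG0.mono Finset.subset_union_left) (by
      intro A hA B hB
      rw [Finset.mem_inter] at hA
      rcases Finset.mem_union.1 hB with h | h
      · exact hx A hA.1 B h
      · exact hxσ A hA.2 B h)
  have hle := o1.2 (by omega)
  have heq : G ∩ pmap σ G = pmap σ G :=
    Finset.eq_of_subset_of_card_le Finset.inter_subset_right (by omega)
  intro B hB
  have : B.map σ.toEmbedding ∈ pmap σ G := (mem_pmap _ _ _).2 ⟨B, hB, rfl⟩
  rw [← heq] at this
  exact (Finset.mem_inter.1 this).1

lemma swap_trans_fam (G : Finset (Finset ℕ)) (u v w : ℕ)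
    (h1 : ∀ B ∈ G, B.map (Equiv.swap u v).toEmbedding ∈ G)
    (h2 : ∀ B ∈ G, B.map (Equiv.swap v w).toEmbedding ∈ G) :
    ∀ B ∈ G, B.map (Equiv.swap u w).toEmbedding ∈ G := by
  intro B hB
  by_cases huv : u = v
  · subst huv; exact h2 B hB
  by_cases hvw : v = w
  · subst hvw; exact h1 B hB
  by_cases huw : u = w
  · subst huw; convert hB; ext y; rw [mem_map_swap]; simp
  have := h1 _ (h2 _ (h1 B hB))
  convert this using 1
  ext y
  simp only [mem_map_swap]
  have e : Equiv.swap u w = Equiv.swap u v * Equiv.swap v w * Equiv.swap u v := by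
    rw [Equiv.swap_comm u v, Equiv.swap_comm v w,
      Equiv.swap_mul_swap_mul_swap (Ne.symm hvw) (Ne.symm huw)]
  rw [e]; rfl

lemma Q_eq (X : Finset ℕ) (b : ℕ) (F G : Finset (Finset ℕ)) (hn : b + b ≤ X.card)
    (hF : F ⊆ X.powersetCard b) (hG : G ⊆ X.powersetCard b) (hF0 : F.Nonempty) (hG0 : G.Nonempty)
    (hx : crossInt F G) : F.card + G.card + (X.card - b).choose b ≤ X.card.choose b + 1 := by
  rcases hn.eq_or_lt with hn | hn
  · have := cross_matching X b b F G hF hG hx le_rfl hn.le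
    rw [← hn]
    simp
    rwa [← hn] at this
  obtain ⟨F', G', hF', hG', hF0', hG0', hx', hle, hopt⟩ := frag_choice _ F G hF hG hF0 hG0 hx
  have hblk := fun u v (hu : u ∈ X) (hv : v ∈ X) =>
    frag_block _ F' G' hF' hG' hF0' hG0' hx' hopt (Equiv.swap u v) (by
      intro A hA
      rw [Finset.mem_powersetCard] at hA ⊢
      exact ⟨map_swap_subset X A u v hu hv hA.1, by rw [Finset.card_map]; exact hA.2⟩)
  have hfix : ∀ B ∈ G', ∀ u ∈ X, ∀ v ∈ X, (u ∈ B ↔ v ∈ B) →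
      ∀ C ∈ G', C.map (Equiv.swap u v).toEmbedding ∈ G' := by
    intro B hB u hu v hv huv
    apply hblk u v hu hv
    refine ⟨B, Finset.mem_inter.2 ⟨hB, (mem_pmap _ _ _).2 ⟨B, hB, ?_⟩⟩⟩
    ext y
    rw [mem_map_swap, Equiv.swap_apply_def]
    split_ifs with h1 h2
    · subst h1; exact huv.symm
    · subst h2; exact huv
    · rfl
  by_cases hone : G'.card = 1
  · obtain ⟨B, rfl⟩ := Finset.card_eq_one.1 hone
    have hB := Finset.mem_powersetCard.1 (hG' (Finset.mem_singleton_self B))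
    have hd : Disjoint F' ((X \ B).powersetCard b) := by
      rw [Finset.disjoint_left]
      intro A hA hA2
      rw [Finset.mem_powersetCard, Finset.subset_sdiff] at hA2
      have := hx' A hA B (Finset.mem_singleton_self B)
      rw [← Finset.not_disjoint_iff_nonempty_inter] at this
      exact this hA2.1.2
    have hu : F' ∪ ((X \ B).powersetCard b) ⊆ X.powersetCard b :=
      Finset.union_subset hF' (Finset.powersetCard_mono Finset.sdiff_subset)
    have := Finset.card_le_card hu
    rw [Finset.card_union_of_disjoint hd, Finset.card_powersetCard, Finset.card_powersetCard,
      Finset.card_sdiff_of_subset hB.1, hB.2] at this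
    omega
  · exfalso
    have h2 : 1 < G'.card := by
      have := Finset.card_pos.2 hG0'
      omega
    obtain ⟨A, hA, B, hB, hAB⟩ := Finset.one_lt_card.1 h2
    have hA' := Finset.mem_powersetCard.1 (hG' hA)
    have hB' := Finset.mem_powersetCard.1 (hG' hB)
    obtain ⟨p, hpA, q, hq, hqA, hpq⟩ : ∃ p ∈ A, ∃ q ∈ X, q ∉ A ∧ (p ∈ B ↔ q ∈ B) := by
      obtain ⟨q, hqB, hqA⟩ : ∃ q ∈ B, q ∉ A := by
        by_contra hcon
        push Not at hcon
        exact hAB (Finset.eq_of_subset_of_card_le hcon (by omega)).symm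
      by_cases hi : ∃ p ∈ A, p ∈ B
      · obtain ⟨p, hpA, hpB⟩ := hi
        exact ⟨p, hpA, q, hB'.1 hqB, hqA, by simp [hpB, hqB]⟩
      · push Not at hi
        obtain ⟨p, hp⟩ : A.Nonempty := by
          rw [← Finset.card_pos, hA'.2, ← hB'.2]
          exact Finset.card_pos.2 ⟨q, hqB⟩
        obtain ⟨r, hr, hr2⟩ : ∃ r ∈ X, r ∉ A ∪ B := by
          by_contra hcon
          push Not at hcon
          have h3 := Finset.card_le_card (show X ⊆ A ∪ B from hcon)
          have h4 := Finset.card_union_le A B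
          omega
        rw [Finset.mem_union, not_or] at hr2
        exact ⟨p, hp, r, hr, hr2.1, by simp [hi p hp, hr2.2]⟩
    have hR := hfix B hB p (hA'.1 hpA) q hq hpq
    have hR' : ∀ C ∈ G', C.map (Equiv.swap q p).toEmbedding ∈ G' := by
      rw [Equiv.swap_comm]; exact hR
    have hall : ∀ u ∈ X, ∀ v ∈ X, ∀ C ∈ G', C.map (Equiv.swap u v).toEmbedding ∈ G' := by
      intro u hu v hv
      by_cases h1 : u ∈ A <;> by_cases h2 : v ∈ A
      · exact hfix A hA u hu v hv (by simp [h1, h2])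
      · exact swap_trans_fam _ u p v (hfix A hA u hu p (hA'.1 hpA) (by simp [h1, hpA]))
          (swap_trans_fam _ p q v hR (hfix A hA q hq v hv (by simp [hqA, h2])))
      · exact swap_trans_fam _ u q v (hfix A hA u hu q hq (by simp [h1, hqA]))
          (swap_trans_fam _ q p v hR' (hfix A hA p (hA'.1 hpA) v hv (by simp [hpA, h2])))
      · exact hfix A hA u hu v hv (by simp [h1, h2])
    obtain ⟨D, hD⟩ := hF0'
    have hD' := Finset.mem_powersetCard.1 (hF' hD)
    obtain ⟨C, hC, hmin⟩ := G'.exists_min_image (fun C => (D ∩ C).card) hG0'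
    have hC' := Finset.mem_powersetCard.1 (hG' hC)
    obtain ⟨x, hxx⟩ := hx' D hD C hC
    rw [Finset.mem_inter] at hxx
    obtain ⟨y, hy, hy2⟩ : ∃ r ∈ X, r ∉ D ∪ C := by
      by_contra hcon
      push Not at hcon
      have h3 := Finset.card_le_card (show X ⊆ D ∪ C from hcon)
      have h4 := Finset.card_union_le D C
      omega
    rw [Finset.mem_union, not_or] at hy2
    have := hmin _ (hall x (hD'.1 hxx.1) y hy C hC)
    have hlt : (D ∩ C.map (Equiv.swap x y).toEmbedding).card < (D ∩ C).card := by
      apply Finset.card_lt_card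
      rw [Finset.ssubset_iff_of_subset]
      · refine ⟨x, Finset.mem_inter.2 hxx, ?_⟩
        rw [Finset.mem_inter, mem_map_swap, Equiv.swap_apply_left]
        exact fun h => hy2.2 h.2
      · intro z hz
        rw [Finset.mem_inter, mem_map_swap, Equiv.swap_apply_def] at hz
        rw [Finset.mem_inter]
        refine ⟨hz.1, ?_⟩
        obtain ⟨hz1, hz2⟩ := hz
        split_ifs at hz2 with h1 h2
        · exact absurd hz2 hy2.2
        · subst h2; exact absurd hz1 hy2.1
        · exact hz2
    omega

lemma T_bound (b : ℕ) (hb : 1 ≤ b) (t : ℕ) :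
    ∀ (X : Finset ℕ) (a : ℕ) (F G : Finset (Finset ℕ)),
    b * (t + 1) ≤ X.card → F ⊆ X.powersetCard a → G ⊆ X.powersetCard b → crossInt F G →
    covX X (t + 1) G → F.Nonempty → b + t ≤ a → a + b ≤ X.card →
    (F.card : ℤ) + G.card ≤ hh b a (t + 1) X.card + (t + 1 : ℕ) := by
  induction t with
  | zero =>
    intro X a F G hn hF hG hFG hcov hF0 ha han
    have hG0 := covX_nonempty _ _ _ hcov
    rcases Nat.eq_or_lt_of_le ha with h | h
    · have h' : b = a := by omega
      subst h'
      have := Q_eq X b F G han hF hG hF0 hG0 hFG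
      simp only [hh]
      push_cast
      omega
    · obtain ⟨a, rfl⟩ : ∃ m, a = m + 1 := ⟨a - 1, by omega⟩
      obtain ⟨B, hB⟩ := hG0
      have hB' := Finset.mem_powersetCard.1 (hG hB)
      obtain ⟨x, hx⟩ : B.Nonempty := Finset.card_pos.1 (by omega)
      have hX' : (X.erase x).card = X.card - 1 := Finset.card_erase_of_mem (hB'.1 hx)
      refine (T_step b 0 hb X a F G B x hn hF hG hFG hcov hB hx (by omega) han ?_).1
      have := cross_matching (X.erase x) a b _ _ (member_sub _ _ _ _ hF) (nonmember_sub _ _ _ _ hG)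
        (cross_mn _ _ x hFG) (by omega) (by omega)
      rw [hX'] at this
      simp only [hh]
      push_cast
      omega
  | succ t ih =>
    intro X a F G hn hF hG hFG hcov hF0 ha han
    obtain ⟨a, rfl⟩ : ∃ m, a = m + 1 := ⟨a - 1, by omega⟩
    obtain ⟨B, hB⟩ := covX_nonempty _ _ _ hcov
    obtain ⟨A, hA⟩ := hF0
    obtain ⟨x, hxx⟩ := hFG A hA B hB
    rw [Finset.mem_inter] at hxx
    have hB' := Finset.mem_powersetCard.1 (hG hB)
    have hX' : (X.erase x).card = X.card - 1 := Finset.card_erase_of_mem (hB'.1 hxx.2)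
    have e : b * (t + 1 + 1) = b * (t + 1) + b := by ring
    refine (T_step b (t + 1) hb X a F G B x hn hF hG hFG hcov hB hxx.2 (by omega) han ?_).1
    rw [← hX']
    exact ih (X.erase x) a _ _ (by omega) (member_sub _ _ _ _ hF) (nonmember_sub _ _ _ _ hG)
        (cross_mn _ _ x hFG) (covX_nonmember _ _ _ _ (hB'.1 hxx.2) hcov)
        ⟨A.erase x, by rw [Finset.mem_memberSubfamily, Finset.insert_erase hxx.1]; exact ⟨hA, by simp⟩⟩
        (by omega) (by omega)

/-- In an extremal pair, an element of `A ∩ B` lies in no other member of `G`. -/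
lemma T_unique (b : ℕ) (hb : 2 ≤ b) (t : ℕ) (X : Finset ℕ) (a : ℕ) (F G : Finset (Finset ℕ))
    (hn : b * (t + 2) ≤ X.card) (hF : F ⊆ X.powersetCard a) (hG : G ⊆ X.powersetCard b)
    (hFG : crossInt F G) (hcov : covX X (t + 2) G) (ha : b + t + 1 ≤ a) (han : a + b < X.card)
    (heq : (F.card : ℤ) + G.card = hh b a (t + 2) X.card + (t + 2 : ℕ))
    (A : Finset ℕ) (hA : A ∈ F) (B : Finset ℕ) (hB : B ∈ G) (x : ℕ) (hxA : x ∈ A) (hxB : x ∈ B)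
    (D : Finset ℕ) (hD : D ∈ G) (hxD : x ∈ D) : D = B := by
  by_contra hne
  obtain ⟨a, rfl⟩ : ∃ m, a = m + 1 := ⟨a - 1, by omega⟩
  have hB' := Finset.mem_powersetCard.1 (hG hB)
  have hX' : (X.erase x).card = X.card - 1 := Finset.card_erase_of_mem (hB'.1 hxB)
  have e : b * (t + 2) = b * (t + 1) + b := by ring
  have := (T_step b (t + 1) (by omega) X a F G B x hn hF hG hFG hcov hB hxB (by omega) han.le (by
    rw [← hX']
    exact T_bound b (by omega) t (X.erase x) a _ _ (by omega) (member_sub _ _ _ _ hF)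
        (nonmember_sub _ _ _ _ hG)
        (cross_mn _ _ x hFG) (covX_nonmember _ _ _ _ (hB'.1 hxB) hcov)
        ⟨A.erase x, by rw [Finset.mem_memberSubfamily, Finset.insert_erase hxA]; exact ⟨hA, by simp⟩⟩
        (by omega) (by omega))).2 t rfl hb han D hD hne hxD
  rw [show t + 1 + 1 = t + 2 from rfl] at this
  omega

lemma covX_of_disjoint (X : Finset ℕ) (G : Finset (Finset ℕ))
    (hd : ∀ B ∈ G, ∀ C ∈ G, B ≠ C → Disjoint B C) : covX X G.card G := by
  intro T _ hT
  choose! f hf using hT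
  apply Finset.card_le_card_of_injOn f
  · intro B hB; exact (Finset.mem_inter.1 (hf B hB)).1
  · intro B hB C hC hBC
    by_contra hne
    have h1 := (Finset.mem_inter.1 (hf B hB)).2
    have h2 := (Finset.mem_inter.1 (hf C hC)).2
    rw [← hBC] at h2
    exact Finset.disjoint_left.1 (hd B hB C hC hne) h1 h2

lemma T_eq (b : ℕ) (hb : 2 ≤ b) (t : ℕ) (X : Finset ℕ) (a : ℕ) (F G : Finset (Finset ℕ))
    (hn : b * (t + 2) ≤ X.card) (hF : F ⊆ X.powersetCard a) (hG : G ⊆ X.powersetCard b)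
    (hFG : crossInt F G) (hcov : covX X (t + 2) G) (hF0 : F.Nonempty)
    (ha : b + t + 1 ≤ a) (han : a + b < X.card)
    (heq : (F.card : ℤ) + G.card = hh b a (t + 2) X.card + (t + 2 : ℕ)) :
    (∀ B ∈ G, ∀ C ∈ G, B ≠ C → Disjoint B C) ∧ G.card = t + 2 ∧
    F = (X.powersetCard a).filter (fun A => ∀ B ∈ G, (A ∩ B).Nonempty) := by
  have huniq := T_unique b hb t X a F G hn hF hG hFG hcov ha han heq
  have hmax : ∀ A ∈ X.powersetCard a, (∀ B ∈ G, (A ∩ B).Nonempty) → A ∈ F := by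
    intro A hA hAG
    by_contra hAF
    have := T_bound b (by omega) (t + 1) X a (insert A F) G hn (Finset.insert_subset hA hF) hG (by
      intro A' hA' B hB
      rcases Finset.mem_insert.1 hA' with rfl | h
      · exact hAG B hB
      · exact hFG A' h B hB) hcov (Finset.insert_nonempty _ _) (by omega) han.le
    rw [Finset.card_insert_of_notMem hAF] at this
    push_cast at this heq
    rw [show t + 1 + 1 = t + 2 from rfl] at this
    linarith
  obtain ⟨A, hA⟩ := hF0
  have hA' := Finset.mem_powersetCard.1 (hF hA)
  have hdisj : ∀ B ∈ G, ∀ C ∈ G, B ≠ C → Disjoint B C := by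
    intro B hB C hC hBC
    rw [Finset.disjoint_left]
    intro x hxB hxC
    by_cases hxA : x ∈ A
    · exact hBC (huniq A hA B hB x hxA hxB C hC hxC).symm
    obtain ⟨y, hy⟩ := hFG A hA B hB
    rw [Finset.mem_inter] at hy
    have hin : insert x (A.erase y) ∈ F := by
      apply hmax
      · rw [Finset.mem_powersetCard]
        constructor
        · exact Finset.insert_subset ((Finset.mem_powersetCard.1 (hG hB)).1 hxB)
            ((Finset.erase_subset _ _).trans hA'.1)
        · rw [Finset.card_insert_of_notMem (fun h => hxA (Finset.mem_of_mem_erase h)),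
            Finset.card_erase_add_one hy.1, hA'.2]
      · intro D hD
        by_cases hDB : D = B
        · subst hDB; exact ⟨x, by simp [hxB]⟩
        · obtain ⟨z, hz⟩ := hFG A hA D hD
          rw [Finset.mem_inter] at hz
          refine ⟨z, ?_⟩
          have hzy : z ≠ y := by
            rintro rfl
            exact hDB (huniq A hA B hB z hy.1 hy.2 D hD hz.2)
          simp [hz, hzy]
    exact hBC (huniq _ hin B hB x (Finset.mem_insert_self _ _) hxB C hC hxC).symm
  refine ⟨hdisj, ?_, ?_⟩
  · have hge : t + 2 ≤ G.card := by
      obtain ⟨f, hf⟩ : ∃ f : Finset ℕ → ℕ, ∀ B ∈ G, f B ∈ B := by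
        choose! f hf using fun B hB => hFG A hA B hB
        exact ⟨f, fun B hB => (Finset.mem_inter.1 (hf B hB)).2⟩
      have := hcov (G.image f) (by
        intro y hy
        obtain ⟨B, hB, rfl⟩ := Finset.mem_image.1 hy
        exact (Finset.mem_powersetCard.1 (hG hB)).1 (hf B hB)) (by
        intro B hB
        exact ⟨f B, Finset.mem_inter.2 ⟨Finset.mem_image_of_mem _ hB, hf B hB⟩⟩)
      exact this.trans Finset.card_image_le
    by_contra hne
    obtain ⟨B, hB⟩ := covX_nonempty _ _ _ hcov
    have hB' := Finset.mem_powersetCard.1 (hG hB)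
    have hcE := Finset.card_erase_add_one hB
    have hk : 0 < (A ∩ B).card := Finset.card_pos.2 (hFG A hA B hB)
    have hun := Finset.card_union_add_card_inter A B
    have hR : (X \ (A ∪ B)).card = X.card - (A ∪ B).card :=
      Finset.card_sdiff_of_subset (Finset.union_subset hA'.1 hB'.1)
    have h2 : 1 < ((X \ (A ∪ B)).powersetCard (A ∩ B).card).card := by
      rw [Finset.card_powersetCard]
      exact choose_ge_two _ _ hk (by omega)
    set W := ((X \ (A ∪ B)).powersetCard (A ∩ B).card).image (fun K => (A \ B) ∪ K) with hW
    have hWc : 1 < W.card := by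
      rw [hW, Finset.card_image_of_injOn]
      · exact h2
      · intro K hK L hL hKL
        have hK1 := (Finset.mem_powersetCard.1 hK).1
        have hL1 := (Finset.mem_powersetCard.1 hL).1
        simp only at hKL
        have hh1 : ∀ M, M ⊆ X \ (A ∪ B) → ((A \ B) ∪ M) \ A = M := by
          intro M hM
          ext y
          have := @hM y
          simp only [Finset.mem_sdiff, Finset.mem_union] at this ⊢
          tauto
        rw [← hh1 K hK1, hKL, hh1 L hL1]
    have hWd : ∀ D ∈ W, Disjoint D B ∧ D ∈ X.powersetCard a ∧ A \ B ⊆ D := by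
      intro D hD
      obtain ⟨K, hK, rfl⟩ := Finset.mem_image.1 hD
      have hK1 := Finset.mem_powersetCard.1 hK
      have hd1 : Disjoint (A \ B) K := by
        rw [Finset.disjoint_left]
        intro y hy hyK
        have := hK1.1 hyK
        simp only [Finset.mem_sdiff, Finset.mem_union] at this hy
        tauto
      refine ⟨?_, ?_, Finset.subset_union_left⟩
      · rw [Finset.disjoint_left]
        intro y hy hyB
        rcases Finset.mem_union.1 hy with h | h
        · exact (Finset.mem_sdiff.1 h).2 hyB
        · have := hK1.1 h
          simp only [Finset.mem_sdiff, Finset.mem_union] at this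
          tauto
      · rw [Finset.mem_powersetCard]
        constructor
        · exact Finset.union_subset (Finset.sdiff_subset.trans hA'.1) (hK1.1.trans Finset.sdiff_subset)
        · rw [Finset.card_union_of_disjoint hd1, hK1.2, Finset.card_sdiff_add_card_inter, hA'.2]
    have hFW : Disjoint F W := by
      rw [Finset.disjoint_left]
      intro D hDF hDW
      have := hFG D hDF B hB
      rw [← Finset.not_disjoint_iff_nonempty_inter] at this
      exact this (hWd D hDW).1
    have hcovE : covX X (t + 2) (G.erase B) := by
      intro T hT hTc
      have := covX_of_disjoint X (G.erase B) (fun C hC D hD =>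
        hdisj C (Finset.mem_of_mem_erase hC) D (Finset.mem_of_mem_erase hD)) T hT hTc
      omega
    have := T_bound b (by omega) (t + 1) X a (F ∪ W) (G.erase B) hn
      (Finset.union_subset hF (fun D hD => (hWd D hD).2.1)) ((Finset.erase_subset _ _).trans hG) (by
        intro D hD C hC
        have hCG := Finset.mem_of_mem_erase hC
        rcases Finset.mem_union.1 hD with h | h
        · exact hFG D h C hCG
        · obtain ⟨z, hz⟩ := hFG A hA C hCG
          rw [Finset.mem_inter] at hz
          refine ⟨z, Finset.mem_inter.2 ⟨(hWd D h).2.2 (Finset.mem_sdiff.2 ⟨hz.1, fun hzB => ?_⟩), hz.2⟩⟩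
          exact (Finset.ne_of_mem_erase hC) (huniq A hA B hB z hz.1 hzB C hCG hz.2))
      hcovE ⟨A, Finset.mem_union_left _ hA⟩ (by omega) han.le
    rw [Finset.card_union_of_disjoint hFW] at this
    rw [show t + 1 + 1 = t + 2 from rfl] at this
    push_cast at this heq
    omega
  · ext D
    rw [Finset.mem_filter]
    exact ⟨fun h => ⟨hF h, fun B hB => hFG D h B hB⟩, fun h => hmax D h.1 h.2⟩


theorem stmt4 (n a b s t : ℕ) (hb : 2 ≤ b) (hs : 2 ≤ s) (ht : 2 ≤ t)
    (habt : b + t ≤ a + 1) (hnab : a + b ≤ n) (hnbt : b * t ≤ n)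
    (F G : Finset (Finset ℕ))
    (hF : F ⊆ (Finset.Icc 1 n).powersetCard a)
    (hG : G ⊆ (Finset.Icc 1 n).powersetCard b)
    (hcross : crossInt F G)
    (hFcov : coverGE n s F)
    (hGcov : coverGE n t G) :
    (F.card : ℤ) + G.card ≤ MtSize n a b t ∧
    (a + b < n →
      ((F.card : ℤ) + G.card = MtSize n a b t ↔
        ∃ B : Fin t → Finset ℕ,
      (∀ i, B i ⊆ Finset.Icc 1 n ∧ (B i).card = b) ∧
      (∀ i j, i ≠ j → Disjoint (B i) (B j)) ∧
      G = Finset.image B Finset.univ ∧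
      F = ((Finset.Icc 1 n).powersetCard a).filter (fun A => ∀ i, (A ∩ B i).Nonempty))) := by
  have hXc : (Finset.Icc 1 n).card = n := by simp
  obtain ⟨u, rfl⟩ : ∃ u, t = u + 2 := ⟨t - 2, by omega⟩
  have hF0 : F.Nonempty := by
    rw [Finset.nonempty_iff_ne_empty]
    rintro rfl
    have := hFcov ∅ (Finset.empty_subset _) (by simp)
    simp at this
    omega
  have hcov : covX (Finset.Icc 1 n) (u + 2) G := hGcov
  rw [MtSize_eq]
  refine ⟨?_, fun hlt => ⟨fun heq => ?_, ?_⟩⟩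
  · have := T_bound b (by omega) (u + 1) (Finset.Icc 1 n) a F G (by rw [hXc]; exact hnbt) hF hG
      hcross hcov hF0 (by omega) (by omega)
    rwa [hXc] at this
  · obtain ⟨h1, h2, h3⟩ := T_eq b hb u (Finset.Icc 1 n) a F G (by rw [hXc]; exact hnbt) hF hG
      hcross hcov hF0 (by omega) (by omega) (by rw [hXc]; exact heq)
    let e := G.equivFinOfCardEq h2
    have hGB : G = Finset.image (fun i => (e.symm i : Finset ℕ)) Finset.univ := by
      ext D
      simp only [Finset.mem_image, Finset.mem_univ, true_and]
      constructor
      · intro hD; exact ⟨e ⟨D, hD⟩, by simp⟩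
      · rintro ⟨i, rfl⟩; exact (e.symm i).2
    refine ⟨fun i => (e.symm i : Finset ℕ), fun i => ?_, fun i j hij => ?_, hGB, ?_⟩
    · exact Finset.mem_powersetCard.1 (hG (e.symm i).2)
    · apply h1 _ (e.symm i).2 _ (e.symm j).2
      intro h
      exact hij (e.symm.injective (Subtype.ext h))
    · rw [h3]
      apply Finset.filter_congr
      intro A _
      constructor
      · intro h i; exact h _ (e.symm i).2
      · intro h B hB
        have := h (e ⟨B, hB⟩)
        simpa using this
  · rintro ⟨B, h1, h2, rfl, rfl⟩
    have hinj : Function.Injective B := by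
      intro i j hij
      by_contra hne
      have := h2 i j hne
      rw [hij, disjoint_self] at this
      have h3 := (h1 j).2
      rw [this] at h3
      simp at h3
      omega
    have hc : (Finset.image B Finset.univ).card = u + 2 := by
      rw [Finset.card_image_of_injective _ hinj]; simp
    have := card_meet b a (Finset.image B Finset.univ) (Finset.Icc 1 n) (by
      intro C hC
      obtain ⟨i, _, rfl⟩ := Finset.mem_image.1 hC
      exact h1 i) (by
      intro C hC D hD hne
      obtain ⟨i, _, rfl⟩ := Finset.mem_image.1 hC
      obtain ⟨j, _, rfl⟩ := Finset.mem_image.1 hD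
      exact h2 i j (fun h => hne (h ▸ rfl)))
    rw [hc, hXc] at this
    rw [hc, ← this]
    congr 3
    apply Finset.filter_congr
    intro A _
    simp
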